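/- arXiv:2603.26409 — 7 statements merged into one kernel-verified Lean document; each statement's English description precedes it below -/
import Mathlib

section
/- Let m and n be positive integers with gcd(m, n) = 1. Then the quotient ring R = (ℤ_m)[x] / ⟨x^n − 1⟩ is a principal ideal ring, i.e., every ideal of R is generated by a single element. -/
/-- Every element of a finite monoid has an idempotent positive power. -/
theorem Monoid.exists_isIdempotentElem_pow {M : Type*} [Monoid M] [Finite M] (g : M) :
    ∃ N, 0 < N ∧ IsIdempotentElem (g ^ N) := by
  obtain ⟨i, d, hd, hid⟩ : ∃ i d, 0 < d ∧ g ^ (i + d) = g ^ i := by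
    obtain ⟨i, j, hij, hne⟩ := Function.not_injective_iff.mp
      (not_injective_infinite_finite fun k : ℕ => g ^ k)
    rcases hne.lt_or_gt with hlt | hlt <;> obtain ⟨d, rfl⟩ := Nat.exists_eq_add_of_lt hlt
    · exact ⟨i, d + 1, d.succ_pos, hij.symm⟩
    · exact ⟨j, d + 1, d.succ_pos, hij⟩
  have hperiod (t k : ℕ) (hk : i ≤ k) : g ^ (k + t * d) = g ^ k := by
    induction t with
    | zero => simp
    | succ t ih =>
      obtain ⟨l, rfl⟩ := Nat.exists_eq_add_of_le' hk
      rw [← ih, show l + i + (t + 1) * d = l + t * d + (i + d) by ring, pow_add, hid, ← pow_add,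
        add_right_comm]
  refine ⟨(i + 1) * d, by positivity, ?_⟩
  rw [IsIdempotentElem, ← pow_add]
  exact hperiod _ _ (by nlinarith)

/-- In a finite commutative ring, an ideal containing an element that generates a radical ideal is
principal. -/
theorem Ideal.isPrincipal_of_mem_of_isRadical_span {R : Type*} [CommRing R] [Finite R]
    {I : Ideal R} {p : R} (hp : p ∈ I) (hrad : (Ideal.span {p}).IsRadical) :
    I.IsPrincipal := by
  set J := Ideal.span {p} with hJ
  have : IsReduced (R ⧸ J) := (Ideal.isRadical_iff_quotient_reduced J).mp hrad
  have : Finite (R ⧸ J) := Finite.of_surjective _ (Ideal.Quotient.mk_surjective (I := J))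
  have : IsSemisimpleRing (R ⧸ J) := IsArtinianRing.isSemisimpleRing_of_isReduced _
  obtain ⟨gq, hgq⟩ := (IsPrincipalIdealRing.principal (I.map (Ideal.Quotient.mk J))).principal
  obtain ⟨g, rfl⟩ := Ideal.Quotient.mk_surjective gq
  have hJI : J ≤ I := (Ideal.span_singleton_le_iff_mem I).mpr hp
  have hg : g ∈ I := by
    have : Ideal.Quotient.mk J g ∈ I.map (Ideal.Quotient.mk J) :=
      hgq ▸ Submodule.mem_span_singleton_self _
    rwa [← Ideal.mem_comap, Ideal.comap_map_mk hJI] at this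
  obtain ⟨N, hN, he⟩ := Monoid.exists_isIdempotentElem_pow g
  set e := g ^ N with hedef
  have heI : e ∈ I := Ideal.pow_mem_of_mem I hg N hN
  have hge : g * (1 - e) ∈ J := hrad ⟨N, by
    rw [mul_pow, ← hedef]
    obtain ⟨k, rfl⟩ := Nat.exists_eq_succ_of_ne_zero hN.ne'
    rw [pow_succ', ← mul_assoc, mul_sub, he.eq]
    simp⟩
  have hee : e * e = e := he.eq
  refine ⟨e + p * (1 - e), le_antisymm (fun x hx => ?_) ?_⟩
  · set K := Ideal.span {e + p * (1 - e)} with hK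
    have ha : e + p * (1 - e) ∈ K := Ideal.mem_span_singleton_self _
    have heK : e ∈ K := by
      convert K.mul_mem_left e ha using 1
      linear_combination (p - 1) * hee
    have hpK : p ∈ K := by
      convert K.add_mem (K.mul_mem_left p heK) (K.sub_mem ha heK) using 1
      ring
    have hJK : J ≤ K := (Ideal.span_singleton_le_iff_mem K).mpr hpK
    have hgK : g ∈ K := by
      convert K.add_mem (K.mul_mem_left g heK) (hJK hge) using 1
      ring
    have hxq := Ideal.mem_map_of_mem (Ideal.Quotient.mk J) hx
    rw [hgq] at hxq
    obtain ⟨c, hc⟩ := Submodule.mem_span_singleton.mp hxq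
    obtain ⟨c, rfl⟩ := Ideal.Quotient.mk_surjective c
    rw [smul_eq_mul, ← map_mul, eq_comm, Ideal.Quotient.eq] at hc
    convert K.add_mem (hJK hc) (K.mul_mem_left c hgK) using 1
    ring
  · exact (Ideal.span_singleton_le_iff_mem I).mpr
      (I.add_mem heI (I.mul_mem_right _ hp))

open Polynomial in
/-- If the reduction modulo `p ∣ m` of a polynomial `q` over `ZMod m` is squarefree, then `p`
generates a radical ideal of the quotient by `q`. -/
theorem ZMod.isRadical_span_natCast_quotient {m p : ℕ} [Fact p.Prime] (hpm : p ∣ m)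
    {q : (ZMod m)[X]} (hq : Squarefree (q.map (ZMod.castHom hpm (ZMod p)))) :
    (Ideal.span {(p : (ZMod m)[X] ⧸ Ideal.span {q})}).IsRadical := by
  set φ := ZMod.castHom hpm (ZMod p)
  have hφ : Function.Surjective φ := ZMod.castHom_surjective hpm
  have hpφ : φ p = 0 := by simp
  have hker (z : ZMod m) (hz : φ z = 0) : (p : ZMod m) ∣ z := by
    obtain ⟨k, rfl⟩ := ZMod.intCast_surjective z
    rw [map_intCast, ZMod.intCast_zmod_eq_zero_iff_dvd] at hz
    simpa using map_dvd (Int.castRingHom (ZMod m)) hz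
  rintro f ⟨k, hk⟩
  obtain ⟨f, rfl⟩ := Ideal.Quotient.mk_surjective f
  obtain ⟨a, ha⟩ := Ideal.mem_span_singleton'.mp hk
  obtain ⟨a, rfl⟩ := Ideal.Quotient.mk_surjective a
  rw [← map_natCast (Ideal.Quotient.mk (Ideal.span {q})), ← map_mul, ← map_pow, eq_comm,
    Ideal.Quotient.eq, Ideal.mem_span_singleton] at ha
  have hdvd : q.map φ ∣ (f.map φ) ^ k := by
    simpa using map_dvd (mapRingHom φ) ha
  obtain ⟨b, hb⟩ := hq.isRadical k _ hdvd
  obtain ⟨b, rfl⟩ := map_surjective φ hφ b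
  have hC : C (p : ZMod m) ∣ f - q * b := by
    refine C_dvd_iff_dvd_coeff _ _ |>.mpr fun i => hker _ ?_
    rw [← coeff_map, Polynomial.map_sub, Polynomial.map_mul, hb, sub_self, coeff_zero]
  obtain ⟨c, hc⟩ := hC
  refine Ideal.mem_span_singleton'.mpr ⟨Ideal.Quotient.mk _ c, ?_⟩
  rw [← map_natCast (Ideal.Quotient.mk (Ideal.span {q})), ← map_mul, eq_comm,
    Ideal.Quotient.eq, Ideal.mem_span_singleton]
  refine ⟨b, ?_⟩
  rw [map_natCast] at hc
  linear_combination hc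

/-- For `gcd(m, n) = 1`, the ring `(ℤ/m)[x] / ⟨xⁿ - 1⟩` is a principal ideal ring. -/
theorem stmt_3 (m n : ℕ) (hm : 0 < m) (hn : 0 < n) (h : Nat.Coprime m n) :
    IsPrincipalIdealRing
      (Polynomial (ZMod m) ⧸
        Ideal.span {(Polynomial.X : Polynomial (ZMod m)) ^ n - 1}) := by
  have : NeZero m := ⟨hm.ne'⟩
  set q : Polynomial (ZMod m) := Polynomial.X ^ n - 1 with hq
  have hmonic : q.Monic := by
    simpa using Polynomial.monic_X_pow_sub_C (1 : ZMod m) hn.ne'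
  have : Module.Finite (ZMod m) (Polynomial (ZMod m) ⧸ Ideal.span {q}) :=
    hmonic.finite_quotient
  have : Finite (Polynomial (ZMod m) ⧸ Ideal.span {q}) := Module.finite_of_finite (ZMod m)
  refine IsPrincipalIdealRing.of_prime fun P hP => ?_
  have : Finite ((Polynomial (ZMod m) ⧸ Ideal.span {q}) ⧸ P) :=
    Finite.of_surjective _ (Ideal.Quotient.mk_surjective (I := P))
  obtain ⟨p, hchar⟩ := CharP.exists ((Polynomial (ZMod m) ⧸ Ideal.span {q}) ⧸ P)
  have hp : Fact p.Prime :=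
    ⟨CharP.char_is_prime ((Polynomial (ZMod m) ⧸ Ideal.span {q}) ⧸ P) p⟩
  have hpm : p ∣ m := by
    rw [← CharP.cast_eq_zero_iff ((Polynomial (ZMod m) ⧸ Ideal.span {q}) ⧸ P) p]
    rw [← map_natCast (algebraMap (ZMod m) ((Polynomial (ZMod m) ⧸ Ideal.span {q}) ⧸ P)),
      ZMod.natCast_self, map_zero]
  have hpP : (p : Polynomial (ZMod m) ⧸ Ideal.span {q}) ∈ P := by
    rw [← Ideal.Quotient.eq_zero_iff_mem, map_natCast, CharP.cast_eq_zero]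
  refine Ideal.isPrincipal_of_mem_of_isRadical_span hpP
    (ZMod.isRadical_span_natCast_quotient hpm ?_)
  have hpn : (n : ZMod p) ≠ 0 := by
    rw [Ne, ZMod.natCast_eq_zero_iff]
    exact fun hd => hp.out.one_lt.ne' (Nat.eq_one_of_dvd_coprimes h hpm hd)
  simpa [hq] using (Polynomial.X_pow_sub_one_separable_iff.mpr hpn).squarefree
end

section
/- Let p be a prime, e ≥ 1 and n ≥ 1 integers, and let C be a ℤ_{p^e}-submodule of (ℤ_{p^e})^n (a linear code of length n over ℤ_{p^e}). Then there exist natural numbers k_0, k_1, ..., k_{e−1} with k_0 + k_1 + ... + k_{e−1} ≤ n such that C is isomorphic, as an additive group, to the direct sum ⊕_{i=0}^{e−1} (ℤ_{p^{e−i}})^{k_i}; consequently the number of codewords of C is |C| = p^k, where k = Σ_{i=0}^{e−1} k_i·(e−i). -/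
/-- If `p` divides every `m i`, the `p`-torsion of `∏ i, ZMod (m i)` has `p ^ |ι|` elements. -/
lemma ZMod.card_nsmul_eq_zero_pi {ι : Type*} [Fintype ι] {p : ℕ} {m : ι → ℕ}
    (hm : ∀ i, m i ≠ 0) (hp : ∀ i, p ∣ m i) :
    Nat.card {x : (i : ι) → ZMod (m i) // p • x = 0} = p ^ Fintype.card ι := by
  have e : {x : (i : ι) → ZMod (m i) // p • x = 0} ≃
      ((i : ι) → {x : ZMod (m i) // p • x = 0}) :=
    (Equiv.subtypeEquivRight fun x => by simp [funext_iff]).trans Equiv.subtypePiEquivPi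
  have h (i : ι) : Nat.card {x : ZMod (m i) // p • x = 0} = p := by
    have : NeZero (m i) := ⟨hm i⟩
    have h := IsAddCyclic.card_nsmulAddMonoidHom_ker (G := ZMod (m i)) p
    rwa [Nat.card_zmod, Nat.gcd_eq_right (hp i)] at h
  rw [Nat.card_congr e, Nat.card_pi, Finset.prod_congr rfl fun i _ => h i]
  simp

/-- An embedding of products of cyclic groups of orders divisible by `p` does not decrease the
number of factors. -/
lemma ZMod.card_le_card_of_injective_pi {ι κ : Type*} [Fintype ι] [Fintype κ] {p : ℕ}
    (hp : 1 < p) {m : ι → ℕ} {l : κ → ℕ} (hm : ∀ i, m i ≠ 0) (hpm : ∀ i, p ∣ m i)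
    (hl : ∀ i, l i ≠ 0) (hpl : ∀ i, p ∣ l i)
    (f : ((i : ι) → ZMod (m i)) →+ ((i : κ) → ZMod (l i))) (hf : Function.Injective f) :
    Fintype.card ι ≤ Fintype.card κ := by
  have (i : κ) : NeZero (l i) := ⟨hl i⟩
  have h := Nat.card_le_card_of_injective _
    (Subtype.map_injective (p := fun x => p • x = 0) (q := fun y => p • y = 0)
      (fun x hx => by rw [← map_nsmul, hx, map_zero]) hf)
  rw [card_nsmul_eq_zero_pi hm hpm, card_nsmul_eq_zero_pi hl hpl] at h
  exact (Nat.pow_le_pow_iff_right hp).1 h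

/-- A product of cyclic groups can be regrouped along the fibres of a map on the index set. -/
lemma ZMod.nonempty_pi_addEquiv_fiber {ι κ : Type*} [Fintype ι] [DecidableEq κ]
    (f : ι → κ) (m : κ → ℕ) :
    Nonempty (((j : ι) → ZMod (m (f j))) ≃+
      ((i : κ) → Fin (Fintype.card {j // f j = i}) → ZMod (m i))) := by
  let g : (Σ i, Fin (Fintype.card {j // f j = i})) ≃ ι :=
    (Equiv.sigmaCongrRight fun i => (Fintype.equivFin {j // f j = i}).symm).trans
      (Equiv.sigmaFiberEquiv f)
  have hg (s) : f (g s) = s.1 := ((Fintype.equivFin {j // f j = s.1}).symm s.2).2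
  exact ⟨(LinearEquiv.piCongrLeft ℤ (fun j => ZMod (m (f j))) g).symm.toAddEquiv.trans <|
    (AddEquiv.piCongrRight fun s => (ZMod.ringEquivCongr (congrArg m (hg s))).toAddEquiv).trans
      (LinearEquiv.piCurry ℤ fun i _ => ZMod (m i)).toAddEquiv⟩

/-- A finite abelian group killed by `p ^ e` is a product of cyclic groups of orders `p ^ d` with
`0 < d ≤ e`. -/
lemma AddCommGroup.exists_addEquiv_pi_zmod_prime_pow {G : Type*} [AddCommGroup G] [Finite G]
    {p e : ℕ} (hp : p.Prime) (hG : ∀ x : G, p ^ e • x = 0) :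
    ∃ (ι : Type) (_ : Fintype ι) (d : ι → ℕ), (∀ i, 0 < d i ∧ d i ≤ e) ∧
      Nonempty (G ≃+ ((i : ι) → ZMod (p ^ d i))) := by
  classical
  obtain ⟨ι, _, m, hm, ⟨φ⟩⟩ := AddCommGroup.equiv_directSum_zmod_of_finite' G
  let ψ : G ≃+ ((i : ι) → ZMod (m i)) := φ.trans (DirectSum.addEquivProd _)
  have hdvd (i : ι) : m i ∣ p ^ e := by
    have h := congrFun (congrArg ψ (hG (ψ.symm (Pi.single i 1)))) i
    rw [map_nsmul, map_zero, ψ.apply_symm_apply] at h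
    rw [← ZMod.natCast_eq_zero_iff]
    simpa using h
  choose d hde hd using fun i => (Nat.dvd_prime_pow hp).1 (hdvd i)
  refine ⟨ι, ‹_›, d, fun i => ⟨Nat.pos_of_ne_zero fun h => ?_, hde i⟩, ?_⟩
  · exact absurd (hm i) (by simp [hd, h])
  · exact ⟨ψ.trans (AddEquiv.piCongrRight fun i => (ZMod.ringEquivCongr (hd i)).toAddEquiv)⟩


/-- Every linear code `C` over `ℤ/pᵉ` has a subtype `(k₀, ..., k_{e-1})` with
`k₀ + ... + k_{e-1} ≤ n`: as an additive group, `C ≅ ⊕_{i<e} (ℤ/p^{e-i})^{kᵢ}`,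
and consequently `|C| = p^k` with `k = Σ kᵢ (e - i)`. -/
theorem stmt_4 (p e n : ℕ) (hp : p.Prime) (he : 0 < e) (hn : 0 < n)
    (C : Submodule (ZMod (p ^ e)) (Fin n → ZMod (p ^ e))) :
    ∃ k : Fin e → ℕ, (∑ i, k i) ≤ n ∧
      Nonempty (C ≃+ ((i : Fin e) → Fin (k i) → ZMod (p ^ (e - (i : ℕ))))) ∧
      Nat.card C = p ^ (∑ i, k i * (e - (i : ℕ))) := by
  have : NeZero (p ^ e) := ⟨pow_ne_zero _ hp.ne_zero⟩
  obtain ⟨ι, _, d, hd, ⟨φ⟩⟩ := AddCommGroup.exists_addEquiv_pi_zmod_prime_pow (G := C) hp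
    fun x => by rw [← Nat.cast_smul_eq_nsmul (ZMod (p ^ e)), ZMod.natCast_self, zero_smul]
  let f (j : ι) : Fin e := ⟨e - d j, by have := hd j; omega⟩
  have hf (j : ι) : d j = e - (f j : ℕ) := by have := hd j; simp only [f]; omega
  obtain ⟨ψ⟩ := ZMod.nonempty_pi_addEquiv_fiber f fun i : Fin e => p ^ (e - (i : ℕ))
  let χ := (φ.trans (AddEquiv.piCongrRight fun j =>
    (ZMod.ringEquivCongr (congrArg (p ^ ·) (hf j))).toAddEquiv)).trans ψ
  refine ⟨fun i => Fintype.card {j // f j = i}, ?_, ⟨χ⟩, ?_⟩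
  · have h := ZMod.card_le_card_of_injective_pi hp.one_lt
      (fun i => pow_ne_zero (d i) hp.ne_zero) (fun i => dvd_pow_self p (hd i).1.ne')
      (fun _ : Fin n => pow_ne_zero e hp.ne_zero) (fun _ => dvd_pow_self p he.ne')
      (C.subtype.toAddMonoidHom.comp φ.symm.toAddMonoidHom)
      (C.injective_subtype.comp φ.symm.injective)
    rwa [← Fintype.card_sigma, Fintype.card_congr (Equiv.sigmaFiberEquiv f),
      ← Fintype.card_fin n]
  · rw [Nat.card_congr χ.toEquiv, Nat.card_pi, ← Finset.prod_pow_eq_pow_sum]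
    refine Finset.prod_congr rfl fun i _ => ?_
    rw [Nat.card_fun, Nat.card_zmod, Nat.card_fin, ← pow_mul, mul_comm]
end

section
/- Let p be a prime, e ≥ 1 and n ≥ 1 integers, and let C be a ℤ_{p^e}-submodule of (ℤ_{p^e})^n. Define the dual code C^⊥ = {x ∈ (ℤ_{p^e})^n : Σ_{i=1}^n x_i·c_i = 0 for all c ∈ C}. Then (C^⊥)^⊥ = C. Equivalently, every linear code C over ℤ_{p^e} is the kernel of a matrix: there exists a matrix H with entries in ℤ_{p^e} such that C = {c ∈ (ℤ_{p^e})^n : H·c^T = 0}. -/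
/-- The dual code of a linear code `C ⊆ Rⁿ`, with respect to the standard
bilinear form `⟨x, c⟩ = Σᵢ xᵢ cᵢ`. -/
def dualCode {R : Type*} [CommRing R] {n : ℕ} (C : Submodule R (Fin n → R)) :
    Submodule R (Fin n → R) where
  carrier := {x | ∀ c ∈ C, ∑ i, x i * c i = 0}
  add_mem' := by
    intro a b ha hb c hc
    simp only [Set.mem_setOf_eq] at ha hb ⊢
    simp [add_mul, Finset.sum_add_distrib, ha c hc, hb c hc]
  zero_mem' := by
    intro c hc
    simp
  smul_mem' := by
    intro r x hx c hc
    simp only [Set.mem_setOf_eq] at hx ⊢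
    simp [smul_eq_mul, mul_assoc, ← Finset.mul_sum, hx c hc]

theorem le_dualCode_dualCode {R : Type*} [CommRing R] {n : ℕ} (C : Submodule R (Fin n → R)) :
    C ≤ dualCode (dualCode C) := by
  intro c hc x hx
  simpa only [mul_comm] using hx c hc

/-- Every complex additive character of `ZMod N` is a multiplicative shift of the standard one. -/
theorem exists_mulShift_stdAddChar_eq {N : ℕ} [NeZero N] (χ : AddChar (ZMod N) ℂ) :
    ∃ y : ZMod N, AddChar.mulShift ZMod.stdAddChar y = χ :=
  ((Fintype.bijective_iff_injective_and_card _).2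
    ⟨AddChar.to_mulShift_inj_of_isPrimitive (ZMod.isPrimitive_stdAddChar N),
      AddChar.card_eq.symm⟩).surjective χ

theorem addChar_sum_eq_prod {ι A M : Type*} [AddCommMonoid A] [CommMonoid M] (ψ : AddChar A M)
    (s : Finset ι) (f : ι → A) : ψ (∑ i ∈ s, f i) = ∏ i ∈ s, ψ (f i) := by
  induction s using Finset.cons_induction with
  | empty => simp
  | cons i s hi ih => simp [AddChar.map_add_eq_mul, ih]

/-- Every complex additive character of `(ZMod N)ⁿ` is `v ↦ e(⟨y, v⟩)` for some vector `y`. -/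
theorem exists_stdAddChar_dotProduct_eq {N n : ℕ} [NeZero N]
    (ψ : AddChar (Fin n → ZMod N) ℂ) :
    ∃ y : Fin n → ZMod N, ∀ v, ψ v = ZMod.stdAddChar (∑ i, y i * v i) := by
  choose y hy using fun i ↦ exists_mulShift_stdAddChar_eq
    (ψ.compAddMonoidHom (AddMonoidHom.single (fun _ : Fin n ↦ ZMod N) i))
  refine ⟨y, fun v ↦ ?_⟩
  conv_lhs => rw [← Finset.univ_sum_single v]
  rw [addChar_sum_eq_prod, addChar_sum_eq_prod]
  refine Finset.prod_congr rfl fun i _ ↦ ?_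
  simpa using (DFunLike.congr_fun (hy i) (v i)).symm

theorem dualCode_dualCode {N n : ℕ} [NeZero N] (C : Submodule (ZMod N) (Fin n → ZMod N)) :
    dualCode (dualCode C) = C := by
  refine le_antisymm (fun x hx ↦ ?_) (le_dualCode_dualCode C)
  rw [← Submodule.Quotient.mk_eq_zero, ← AddChar.forall_apply_eq_zero]
  intro ψ
  obtain ⟨y, hy⟩ := exists_stdAddChar_dotProduct_eq (ψ.compAddMonoidHom C.mkQ.toAddMonoidHom)
  have hyC : y ∈ dualCode C := by
    intro c hc
    apply ZMod.injective_stdAddChar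
    rw [← hy c, AddChar.map_zero_eq_one]
    simp [(Submodule.Quotient.mk_eq_zero C).2 hc]
  have hxy : ∑ i, y i * x i = 0 := by simpa only [mul_comm] using hx y hyC
  simpa [hxy] using hy x

/-- The dual of a finitely generated code is the kernel of a matrix whose rows generate it. -/
theorem exists_matrix_mem_dualCode_iff {R : Type*} [CommRing R] {n : ℕ}
    {D : Submodule R (Fin n → R)} (hD : D.FG) :
    ∃ (a : ℕ) (H : Matrix (Fin a) (Fin n) R), ∀ c, c ∈ dualCode D ↔ H.mulVec c = 0 := by
  obtain ⟨a, H, rfl⟩ := Submodule.fg_iff_exists_fin_generating_family.1 hD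
  refine ⟨a, H, fun c ↦ ⟨fun hc ↦ funext fun j ↦ ?_, fun hc x hx ↦ ?_⟩⟩
  · simpa [Matrix.mulVec, dotProduct, mul_comm] using hc (H j) (Submodule.subset_span ⟨j, rfl⟩)
  · have hle : Submodule.span R (Set.range H) ≤ dualCode (Submodule.span R {c}) := by
      rw [Submodule.span_le]
      rintro _ ⟨j, rfl⟩ d hd
      obtain ⟨r, rfl⟩ := Submodule.mem_span_singleton.1 hd
      have hj : ∑ i, H j i * c i = 0 := congrFun hc j
      simp [mul_left_comm, ← Finset.mul_sum, hj]
    simpa only [mul_comm] using hle hx c (Submodule.mem_span_singleton_self c)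

/-- Every linear code over `ℤ/pᵉ` satisfies `(C^⊥)^⊥ = C`; equivalently, every
linear code is the kernel of a parity-check matrix `H`. -/
theorem stmt_6 (p e n : ℕ) (hp : p.Prime) (he : 0 < e) (hn : 0 < n)
    (C : Submodule (ZMod (p ^ e)) (Fin n → ZMod (p ^ e))) :
    dualCode (dualCode C) = C ∧
      ∃ (a : ℕ) (H : Matrix (Fin a) (Fin n) (ZMod (p ^ e))),
        ∀ c : Fin n → ZMod (p ^ e), c ∈ C ↔ H.mulVec c = 0 := by
  have : NeZero (p ^ e) := ⟨pow_ne_zero e hp.ne_zero⟩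
  refine ⟨dualCode_dualCode C, ?_⟩
  simpa only [dualCode_dualCode C] using
    exists_matrix_mem_dualCode_iff (IsNoetherian.noetherian (dualCode C))
end

section
/- Let p be a prime, e ≥ 1 and n ≥ 1 integers, and let C be a ℤ_{p^e}-submodule of (ℤ_{p^e})^n whose subtype is (k_0, k_1, ..., k_{e−1}), i.e., C is isomorphic as an additive group to ⊕_{i=0}^{e−1} (ℤ_{p^{e−i}})^{k_i}, and set K = k_0 + k_1 + ... + k_{e−1} (so K ≤ n). Then the dual code C^⊥ = {x ∈ (ℤ_{p^e})^n : Σ_i x_i·c_i = 0 for all c ∈ C} has subtype (n−K, k_{e−1}, k_{e−2}, ..., k_1); that is, C^⊥ is isomorphic as an additive group to (ℤ_{p^e})^{n−K} ⊕ ⊕_{j=1}^{e−1} (ℤ_{p^{e−j}})^{k_{e−j}}. -/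
lemma Submodule.card_sup_mul_card_inf {R M : Type*} [Ring R] [AddCommGroup M] [Module R M]
    (S T : Submodule R M) :
    Nat.card ↥(S ⊔ T) * Nat.card ↥(S ⊓ T) = Nat.card S * Nat.card T := by
  have h₁ := Submodule.card_eq_card_quotient_mul_card (Submodule.comap S.subtype (S ⊓ T))
  have h₂ := Submodule.card_eq_card_quotient_mul_card (Submodule.comap (S ⊔ T).subtype T)
  rw [Nat.card_congr (Submodule.comapSubtypeEquivOfLe inf_le_left).toEquiv,
    Submodule.comap_inf, Nat.card_congr (LinearMap.quotientInfEquivSupQuotient S T).toEquiv] at h₁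
  rw [Nat.card_congr (Submodule.comapSubtypeEquivOfLe le_sup_right).toEquiv] at h₂
  rw [h₁, h₂]
  ring

lemma ZMod.sum_stdAddChar_comp {N : ℕ} [NeZero N] {A : Type*} [AddCommGroup A] [Fintype A]
    (f : A →+ ZMod N) [Decidable (∀ a, f a = 0)] :
    ∑ a, (ZMod.stdAddChar (f a) : ℂ) = if ∀ a, f a = 0 then (Fintype.card A : ℂ) else 0 := by
  classical
  have h := AddChar.sum_eq_ite ((ZMod.stdAddChar (N := N)).compAddMonoidHom f)
  have key : (ZMod.stdAddChar (N := N)).compAddMonoidHom f = 0 ↔ ∀ a, f a = 0 := by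
    rw [DFunLike.ext_iff]
    refine forall_congr' fun a => ?_
    rw [AddChar.compAddMonoidHom_apply, AddChar.zero_apply,
      ← AddChar.map_zero_eq_one (ZMod.stdAddChar (N := N))]
    exact ZMod.injective_stdAddChar.eq_iff
  simpa only [key, AddChar.compAddMonoidHom_apply] using h

lemma card_dualCode_mul_card {N n : ℕ} [NeZero N] (D : Submodule (ZMod N) (Fin n → ZMod N)) :
    Nat.card (dualCode D) * Nat.card D = N ^ n := by
  classical
  have hleft (x : Fin n → ZMod N) :
      ∑ c : D, (ZMod.stdAddChar (∑ i, x i * (c : Fin n → ZMod N) i) : ℂ) =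
        if x ∈ dualCode D then (Fintype.card D : ℂ) else 0 := by
    have h := ZMod.sum_stdAddChar_comp (AddMonoidHom.mk'
      (fun c : D => ∑ i, x i * (c : Fin n → ZMod N) i) fun a b => by
        simp [mul_add, Finset.sum_add_distrib])
    simp only [AddMonoidHom.mk'_apply] at h
    rw [h]
    refine if_congr ?_ rfl rfl
    exact ⟨fun h c hc => h ⟨c, hc⟩, fun h c => h c c.2⟩
  have hright (c : D) :
      ∑ x : Fin n → ZMod N, (ZMod.stdAddChar (∑ i, x i * (c : Fin n → ZMod N) i) : ℂ) =
        if c = 0 then (Fintype.card (Fin n → ZMod N) : ℂ) else 0 := by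
    have h := ZMod.sum_stdAddChar_comp (AddMonoidHom.mk'
      (fun x : Fin n → ZMod N => ∑ i, x i * (c : Fin n → ZMod N) i) fun a b => by
        simp [add_mul, Finset.sum_add_distrib])
    simp only [AddMonoidHom.mk'_apply] at h
    rw [h]
    refine if_congr ⟨fun h => ?_, fun h => by simp [h]⟩ rfl rfl
    ext i
    simpa [Pi.single_apply] using h (Pi.single i 1)
  have h := Finset.sum_comm (s := Finset.univ) (t := Finset.univ)
    (f := fun (x : Fin n → ZMod N) (c : D) =>
      (ZMod.stdAddChar (∑ i, x i * (c : Fin n → ZMod N) i) : ℂ))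
  simp only [hleft, hright] at h
  rw [← Finset.sum_filter, Finset.sum_const, Finset.sum_ite_eq' Finset.univ (0 : D),
    if_pos (Finset.mem_univ _), ← Fintype.card_subtype, nsmul_eq_mul] at h
  rw [Nat.card_eq_fintype_card, Nat.card_eq_fintype_card]
  have h' := Nat.cast_injective (R := ℂ) ((Nat.cast_mul _ _).trans h)
  rw [Fintype.card_fun, ZMod.card, Fintype.card_fin] at h'
  exact h'

lemma card_ker_nsmul_congr {A B : Type*} [AddCommGroup A] [AddCommGroup B] (f : A ≃+ B) (d : ℕ) :
    Nat.card (nsmulAddMonoidHom d : A →+ A).ker = Nat.card (nsmulAddMonoidHom d : B →+ B).ker := by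
  refine Nat.card_congr (f.toEquiv.subtypeEquiv fun a => ?_)
  simp [AddMonoidHom.mem_ker, ← map_nsmul]

lemma card_ker_nsmul_pi_zmod {p : ℕ} (hp : p.Prime) {ι : Type*} [Fintype ι] (m : ι → ℕ) (j : ℕ) :
    Nat.card (nsmulAddMonoidHom (p ^ j) : ((i : ι) → ZMod (p ^ m i)) →+ _).ker =
      p ^ ∑ i, min j (m i) := by
  have : ∀ i, NeZero (p ^ m i) := fun i => ⟨(pow_pos hp.pos _).ne'⟩
  have e : (nsmulAddMonoidHom (p ^ j) : ((i : ι) → ZMod (p ^ m i)) →+ _).ker ≃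
      ((i : ι) → (nsmulAddMonoidHom (p ^ j) : ZMod (p ^ m i) →+ _).ker) :=
    (Equiv.subtypeEquivRight fun f => by simp [AddMonoidHom.mem_ker, funext_iff]).trans
      (Equiv.subtypePiEquivPi (p := fun i (x : ZMod (p ^ m i)) =>
        x ∈ (nsmulAddMonoidHom (p ^ j) : ZMod (p ^ m i) →+ _).ker))
  rw [Nat.card_congr e, Nat.card_pi, ← Finset.prod_pow_eq_pow_sum]
  refine Finset.prod_congr rfl fun i _ => ?_
  rw [IsAddCyclic.card_nsmulAddMonoidHom_ker, Nat.card_zmod, min_comm]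
  rcases le_total (m i) j with h | h
  · rw [min_eq_left h, Nat.gcd_eq_left (pow_dvd_pow p h)]
  · rw [min_eq_right h, Nat.gcd_eq_right (pow_dvd_pow p h)]

lemma card_fiber_eq_of_sum_min_eq {ι ι' : Type*} [Fintype ι] [Fintype ι'] (m : ι → ℕ)
    (m' : ι' → ℕ) (h : ∀ j, ∑ i, min j (m i) = ∑ i, min j (m' i)) (t : ℕ) :
    Fintype.card {i // m i = t + 1} = Fintype.card {i // m' i = t + 1} := by
  have hmin (j a : ℕ) : min (j + 1) a = min j a + if j < a then 1 else 0 := by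
    split_ifs <;> omega
  have hlt (t a : ℕ) : (if t < a then 1 else 0) =
      (if a = t + 1 then 1 else 0) + if t + 1 < a then 1 else 0 := by
    split_ifs <;> omega
  have hgt (j : ℕ) : ∑ i, (if j < m i then 1 else 0) = ∑ i, if j < m' i then 1 else 0 := by
    have h₁ := h (j + 1)
    simp only [hmin, Finset.sum_add_distrib] at h₁
    have := h j
    omega
  have h₁ := hgt t
  rw [Finset.sum_congr rfl fun i _ => hlt t (m i), Finset.sum_congr rfl fun i _ => hlt t (m' i),
    Finset.sum_add_distrib, Finset.sum_add_distrib, hgt (t + 1)] at h₁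
  rw [Fintype.card_subtype, Fintype.card_subtype, Finset.card_filter, Finset.card_filter]
  omega

lemma nonempty_pi_zmod_addEquiv_ne_zero (p : ℕ) {ι : Type*} (m : ι → ℕ) :
    Nonempty (((i : ι) → ZMod (p ^ m i)) ≃+ ((i : {i // m i ≠ 0}) → ZMod (p ^ m i))) := by
  classical
  refine ⟨AddEquiv.ofBijective (AddMonoidHom.mk' (fun f (i : {i // m i ≠ 0}) => f i)
    fun _ _ => rfl) ⟨fun f g h => ?_, fun g => ⟨fun i => if hi : m i ≠ 0 then g ⟨i, hi⟩ else 0,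
      funext fun i => dif_pos i.2⟩⟩⟩
  funext i
  by_cases hi : m i = 0
  · have : Subsingleton (ZMod (p ^ m i)) := by
      rw [hi, pow_zero]
      infer_instance
    exact Subsingleton.elim _ _
  · exact congrFun h ⟨i, hi⟩

lemma nonempty_pi_zmod_addEquiv (p : ℕ) {ι ι' : Type*} [Fintype ι] [Fintype ι'] (m : ι → ℕ)
    (m' : ι' → ℕ) (h : ∀ j, ∑ i, min j (m i) = ∑ i, min j (m' i)) :
    Nonempty (((i : ι) → ZMod (p ^ m i)) ≃+ ((i : ι') → ZMod (p ^ m' i))) := by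
  have hfib (t : ℕ) : Nonempty ({i : {i // m i ≠ 0} // m i = t} ≃
      {i : {i // m' i ≠ 0} // m' i = t}) := by
    cases t with
    | zero =>
      have : IsEmpty {i : {i // m i ≠ 0} // m i = 0} := ⟨fun i => i.1.2 i.2⟩
      have : IsEmpty {i : {i // m' i ≠ 0} // m' i = 0} := ⟨fun i => i.1.2 i.2⟩
      exact ⟨Equiv.equivOfIsEmpty _ _⟩
    | succ t =>
      refine ⟨(Equiv.subtypeSubtypeEquivSubtype fun {i} (hi : m i = t + 1) => ?_).trans
        ((Fintype.equivOfCardEq (card_fiber_eq_of_sum_min_eq m m' h t)).trans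
          (Equiv.subtypeSubtypeEquivSubtype fun {i} (hi : m' i = t + 1) => ?_).symm)⟩ <;> omega
  let σ : {i // m i ≠ 0} ≃ {i // m' i ≠ 0} := Equiv.ofFiberEquiv (f := fun i => m i)
    (g := fun i => m' i) fun t => (hfib t).some
  have hσ (i : {i // m i ≠ 0}) : m' (σ i) = m i :=
    Equiv.ofFiberEquiv_map (f := fun i : {i // m i ≠ 0} => m i)
      (g := fun i : {i // m' i ≠ 0} => m' i) (fun t => (hfib t).some) i
  obtain ⟨f⟩ := nonempty_pi_zmod_addEquiv_ne_zero p m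
  obtain ⟨g⟩ := nonempty_pi_zmod_addEquiv_ne_zero p m'
  refine ⟨(f.trans ?_).trans g.symm⟩
  exact (AddEquiv.piCongrRight fun i => (ZMod.ringEquivCongr (by rw [hσ i])).toAddEquiv).trans
    (RingEquiv.piCongrLeft (fun i : {i // m' i ≠ 0} => ZMod (p ^ m' i)) σ).toAddEquiv

lemma exists_addEquiv_pi_zmod {p e : ℕ} (hp : p.Prime) {A : Type*} [AddCommGroup A] [Finite A]
    (hA : ∀ a : A, p ^ e • a = 0) :
    ∃ (d : ℕ) (m : Fin d → ℕ), Nonempty (A ≃+ ((i : Fin d) → ZMod (p ^ m i))) := by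
  have : Module.Finite ℤ A := Module.Finite.of_finite
  obtain ⟨d, m, ⟨f⟩⟩ := Module.torsion_by_prime_power_decomposition (R := ℤ) (M := A)
    (Nat.prime_iff_prime_int.mp hp).irreducible fun a =>
      ⟨⟨(p : ℤ) ^ e, e, rfl⟩, by
        change ((p : ℤ) ^ e) • a = 0
        rw [← Nat.cast_pow, natCast_zsmul, hA]⟩
  classical
  refine ⟨d, m, ⟨f.toAddEquiv.trans ((DirectSum.addEquivProd _).trans
    (AddEquiv.piCongrRight fun i => ?_))⟩⟩
  refine AddEquiv.trans ?_ (Int.quotientSpanNatEquivZMod (p ^ m i)).toAddEquiv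
  exact (Submodule.quotEquivOfEq _ _ (by rw [Nat.cast_pow])).toAddEquiv

lemma nonempty_addEquiv_pi_zmod_of_card_ker {p e : ℕ} (hp : p.Prime) {A : Type*} [AddCommGroup A]
    [Finite A] (hA : ∀ a : A, p ^ e • a = 0) {ι : Type*} [Fintype ι] (m : ι → ℕ)
    (hm : ∀ i, m i ≤ e)
    (h : ∀ j ≤ e, Nat.card (nsmulAddMonoidHom (p ^ j) : A →+ A).ker = p ^ ∑ i, min j (m i)) :
    Nonempty (A ≃+ ((i : ι) → ZMod (p ^ m i))) := by
  obtain ⟨d, m', ⟨f⟩⟩ := exists_addEquiv_pi_zmod hp hA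
  obtain ⟨g⟩ := nonempty_pi_zmod_addEquiv p m' m fun j => by
    refine Nat.pow_right_injective hp.two_le ?_
    change p ^ _ = p ^ _
    rw [← card_ker_nsmul_pi_zmod hp, ← card_ker_nsmul_congr f]
    rcases le_total j e with hj | hj
    · exact h j hj
    · have hker : (nsmulAddMonoidHom (p ^ j) : A →+ A).ker = (nsmulAddMonoidHom (p ^ e)).ker := by
        ext a
        obtain ⟨r, rfl⟩ := Nat.exists_eq_add_of_le hj
        simp [AddMonoidHom.mem_ker, pow_add, mul_comm (p ^ e), mul_smul, hA]
      rw [hker, h e le_rfl]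
      congr 1
      refine Finset.sum_congr rfl fun i _ => ?_
      have := hm i
      omega
  exact ⟨f.trans g⟩

def AddEquiv.piSigmaCurry {ι : Type*} {κ : ι → Type*} (A : (i : ι) → κ i → Type*)
    [∀ i k, AddCommGroup (A i k)] :
    ((s : Σ i, κ i) → A s.1 s.2) ≃+ ((i : ι) → (k : κ i) → A i k) where
  __ := Equiv.piCurry A
  map_add' _ _ := rfl

lemma ZMod.pow_smul_eq_zero_iff {p e j : ℕ} (hp : p.Prime) (hj : j ≤ e) (x : ZMod (p ^ e)) :
    p ^ j • x = 0 ↔ ∃ y, p ^ (e - j) • y = x := by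
  have : NeZero (p ^ e) := ⟨(pow_pos hp.pos _).ne'⟩
  have he : p ^ e = p ^ j * p ^ (e - j) := by rw [← pow_add, Nat.add_sub_cancel' hj]
  constructor
  · intro h
    rw [nsmul_eq_mul, ← ZMod.natCast_zmod_val x, ← Nat.cast_mul, ZMod.natCast_eq_zero_iff] at h
    obtain ⟨y, hy⟩ := Nat.dvd_of_mul_dvd_mul_left (pow_pos hp.pos j) (he.symm.dvd.trans h)
    refine ⟨y, ?_⟩
    rw [nsmul_eq_mul, ← Nat.cast_mul, ← hy, ZMod.natCast_zmod_val]
  · rintro ⟨y, rfl⟩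
    rw [smul_smul, ← he, nsmul_eq_mul, ZMod.natCast_self, zero_mul]

lemma mem_range_lsmul_iff {p e j n : ℕ} (hp : p.Prime) (hj : j ≤ e) (x : Fin n → ZMod (p ^ e)) :
    x ∈ LinearMap.range (LinearMap.lsmul (ZMod (p ^ e)) (Fin n → ZMod (p ^ e)) (p ^ j : ℕ)) ↔
      p ^ (e - j) • x = 0 := by
  simp only [LinearMap.mem_range, LinearMap.lsmul_apply, Nat.cast_smul_eq_nsmul, funext_iff,
    Pi.smul_apply, Pi.zero_apply, ZMod.pow_smul_eq_zero_iff hp (Nat.sub_le e j),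
    Nat.sub_sub_self hj]
  exact ⟨fun ⟨y, h⟩ i => ⟨y i, h i⟩, fun h => ⟨fun i => (h i).choose, fun i => (h i).choose_spec⟩⟩

lemma mem_dualCode_sup_range_lsmul {R : Type*} [CommRing R] {n : ℕ} (C : Submodule R (Fin n → R))
    (r : R) (x : Fin n → R) :
    x ∈ dualCode (C ⊔ LinearMap.range (LinearMap.lsmul R (Fin n → R) r)) ↔
      x ∈ dualCode C ∧ r • x = 0 := by
  constructor
  · refine fun h => ⟨fun c hc => h c (Submodule.mem_sup_left hc), funext fun i => ?_⟩
    have := h (r • Pi.single i 1) (Submodule.mem_sup_right ⟨_, rfl⟩)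
    simpa [Pi.single_apply, mul_comm r] using this
  · rintro ⟨hx, hr⟩ c hc
    obtain ⟨a, ha, _, ⟨b, rfl⟩, rfl⟩ := Submodule.mem_sup.mp hc
    have hb : ∑ i, x i * (r * b i) = ∑ i, (r • x) i * b i :=
      Finset.sum_congr rfl fun i _ => by rw [Pi.smul_apply, smul_eq_mul]; ring
    simp only [LinearMap.lsmul_apply, Pi.add_apply, Pi.smul_apply, smul_eq_mul, mul_add,
      Finset.sum_add_distrib, hx a ha, zero_add]
    simp [hb, hr, -Pi.smul_apply]

lemma card_ker_nsmul_dualCode {p e n j : ℕ} (hp : p.Prime) (hj : j ≤ e)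
    (C : Submodule (ZMod (p ^ e)) (Fin n → ZMod (p ^ e))) :
    Nat.card (nsmulAddMonoidHom (p ^ j) : dualCode C →+ dualCode C).ker *
        (Nat.card C * p ^ (n * (e - j))) =
      p ^ (e * n) * Nat.card (nsmulAddMonoidHom (p ^ (e - j)) : C →+ C).ker := by
  have : NeZero (p ^ e) := ⟨(pow_pos hp.pos _).ne'⟩
  set T := LinearMap.range (LinearMap.lsmul (ZMod (p ^ e)) (Fin n → ZMod (p ^ e)) (p ^ j : ℕ))
    with hT
  have hdual : Nat.card (nsmulAddMonoidHom (p ^ j) : dualCode C →+ dualCode C).ker =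
      Nat.card (dualCode (C ⊔ T)) := by
    refine Nat.card_congr ((Equiv.subtypeEquivRight fun x => ?_).trans
      ((Equiv.subtypeSubtypeEquivSubtypeInter (fun x => x ∈ dualCode C)
        (fun x => p ^ j • x = 0)).trans (Equiv.subtypeEquivRight fun x => ?_)))
    · rw [AddMonoidHom.mem_ker, nsmulAddMonoidHom_apply, Subtype.ext_iff]
      rfl
    · rw [hT, mem_dualCode_sup_range_lsmul, Nat.cast_smul_eq_nsmul]
  have hinf : Nat.card ↥(C ⊓ T) = Nat.card (nsmulAddMonoidHom (p ^ (e - j)) : C →+ C).ker := by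
    refine (Nat.card_congr ((Equiv.subtypeEquivRight fun x => ?_).trans
      ((Equiv.subtypeSubtypeEquivSubtypeInter (fun x => x ∈ C)
        (fun x => p ^ (e - j) • x = 0)).trans (Equiv.subtypeEquivRight fun x => ?_)))).symm
    · rw [AddMonoidHom.mem_ker, nsmulAddMonoidHom_apply, Subtype.ext_iff]
      rfl
    · rw [Submodule.mem_inf, hT, mem_range_lsmul_iff hp hj]
  have hcardT : Nat.card T = p ^ (n * (e - j)) := by
    have h := card_ker_nsmul_pi_zmod hp (fun _ : Fin n => e) (e - j)
    rw [Finset.sum_const, Finset.card_univ, Fintype.card_fin, smul_eq_mul,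
      min_eq_left (Nat.sub_le e j)] at h
    rw [← h]
    refine Nat.card_congr (Equiv.subtypeEquivRight fun x => ?_)
    rw [hT, mem_range_lsmul_iff hp hj]
    rfl
  rw [hdual, ← hcardT, ← Submodule.card_sup_mul_card_inf, ← mul_assoc, card_dualCode_mul_card,
    hinf, pow_mul]

lemma sum_dual_subtype_min {e n j : ℕ} (he : 0 < e) (hj : j ≤ e) (k : ℕ → ℕ)
    (hn : ∑ i ∈ Finset.range e, k i ≤ n) :
    ∑ i ∈ Finset.range e,
        (if i = 0 then n - ∑ i ∈ Finset.range e, k i else k (e - i)) * min j (e - i) +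
      (∑ i ∈ Finset.range e, k i * (e - i) + n * (e - j)) =
    e * n + ∑ i ∈ Finset.range e, k i * min (e - j) (e - i) := by
  have hrefl : ∑ i ∈ Finset.range e,
        (if i = 0 then n - ∑ i ∈ Finset.range e, k i else k (e - i)) * min j (e - i) =
      ∑ i ∈ Finset.range e, k i * min j i + (n - ∑ i ∈ Finset.range e, k i) * j := by
    generalize n - ∑ i ∈ Finset.range e, k i = q
    obtain ⟨d, rfl⟩ := Nat.exists_eq_succ_of_ne_zero he.ne'
    rw [Finset.sum_range_succ', Finset.sum_range_succ' (fun i => k i * min j i),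
      ← Finset.sum_range_reflect (fun i => k (i + 1) * min j (i + 1))]
    simp only [Nat.succ_eq_add_one, if_pos, Nat.sub_zero, min_eq_left hj, Nat.min_zero, mul_zero,
      add_zero]
    congr 1
    refine Finset.sum_congr rfl fun i hi => ?_
    have hi' := Finset.mem_range.mp hi
    rw [if_neg (Nat.succ_ne_zero i)]
    congr 2 <;> [skip; congr 1] <;> omega
  have hpoint : ∑ i ∈ Finset.range e, k i * min j i + ∑ i ∈ Finset.range e, k i * (e - i) =
      ∑ i ∈ Finset.range e, k i * min (e - j) (e - i) + (∑ i ∈ Finset.range e, k i) * j := by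
    rw [Finset.sum_mul, ← Finset.sum_add_distrib, ← Finset.sum_add_distrib]
    refine Finset.sum_congr rfl fun i hi => ?_
    have hi' := Finset.mem_range.mp hi
    rw [← mul_add, ← mul_add]
    congr 1
    omega
  rw [hrefl]
  obtain ⟨q, rfl⟩ := Nat.exists_eq_add_of_le hn
  obtain ⟨r, rfl⟩ := Nat.exists_eq_add_of_le hj
  rw [Nat.add_sub_cancel_left, Nat.add_sub_cancel_left] at *
  linarith

lemma sum_sigma_fin_min {e : ℕ} (c : ℕ → ℕ) (j : ℕ) :
    ∑ s : Σ i : Fin e, Fin (c i), min j (e - (s.1 : ℕ)) =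
      ∑ i ∈ Finset.range e, c i * min j (e - i) := by
  rw [Fintype.sum_sigma, ← Fin.sum_univ_eq_sum_range (fun i => c i * min j (e - i))]
  simp

/-- If `C` has subtype `(k₀, k₁, ..., k_{e-1})` and rank `K = Σ kᵢ`, then the dual
code `C^⊥` has subtype `(n - K, k_{e-1}, k_{e-2}, ..., k₁)`, i.e.
`C^⊥ ≅ (ℤ/pᵉ)^{n-K} ⊕ ⊕_{j=1}^{e-1} (ℤ/p^{e-j})^{k_{e-j}}` as additive groups. -/
theorem stmt_7 (p e n : ℕ) (hp : p.Prime) (he : 0 < e) (hn : 0 < n)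
    (C : Submodule (ZMod (p ^ e)) (Fin n → ZMod (p ^ e)))
    (k : ℕ → ℕ) (K : ℕ) (hK : K = ∑ i ∈ Finset.range e, k i) (hKn : K ≤ n)
    (hsub : Nonempty (C ≃+ ((i : Fin e) → Fin (k i) → ZMod (p ^ (e - (i : ℕ)))))) :
    Nonempty ((dualCode C) ≃+
      ((i : Fin e) → Fin (if (i : ℕ) = 0 then n - K else k (e - (i : ℕ))) →
        ZMod (p ^ (e - (i : ℕ))))) := by
  subst hK
  have : NeZero (p ^ e) := ⟨(pow_pos hp.pos _).ne'⟩
  obtain ⟨f⟩ := hsub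
  have hker (j : ℕ) : Nat.card (nsmulAddMonoidHom (p ^ j) : C →+ C).ker =
      p ^ ∑ i ∈ Finset.range e, k i * min j (e - i) := by
    rw [card_ker_nsmul_congr (f.trans
      (AddEquiv.piSigmaCurry fun (i : Fin e) (_ : Fin (k i)) => ZMod (p ^ (e - (i : ℕ)))).symm),
      card_ker_nsmul_pi_zmod hp fun s : Σ i : Fin e, Fin (k i) => e - (s.1 : ℕ),
      sum_sigma_fin_min]
  have htorsion (D : Submodule (ZMod (p ^ e)) (Fin n → ZMod (p ^ e))) (x : D) : p ^ e • x = 0 := by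
    rw [← Nat.cast_smul_eq_nsmul (ZMod (p ^ e)), ZMod.natCast_self, zero_smul]
  have hcard : Nat.card C = p ^ ∑ i ∈ Finset.range e, k i * (e - i) := by
    have htop : (nsmulAddMonoidHom (p ^ e) : C →+ C).ker = ⊤ := by
      ext x
      simp only [AddMonoidHom.mem_ker, nsmulAddMonoidHom_apply, htorsion C x, AddSubgroup.mem_top]
    have h := hker e
    rw [htop, AddSubgroup.card_top] at h
    rw [h]
    exact congrArg _ (Finset.sum_congr rfl fun i _ => by rw [min_eq_right (Nat.sub_le e i)])
  let c : ℕ → ℕ := fun i => if i = 0 then n - ∑ i ∈ Finset.range e, k i else k (e - i)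
  obtain ⟨g⟩ := nonempty_addEquiv_pi_zmod_of_card_ker hp (htorsion (dualCode C))
    (fun s : Σ i : Fin e, Fin (c i) => e - (s.1 : ℕ)) (fun _ => Nat.sub_le _ _) fun j hj => by
      have h := card_ker_nsmul_dualCode hp hj C
      rw [hker, hcard, ← pow_add, ← pow_add, ← sum_dual_subtype_min he hj k hKn] at h
      rw [sum_sigma_fin_min]
      exact Nat.eq_of_mul_eq_mul_right (pow_pos hp.pos _) (h.trans (pow_add p _ _))
  exact ⟨g.trans
    (AddEquiv.piSigmaCurry fun (i : Fin e) (_ : Fin (c i)) => ZMod (p ^ (e - (i : ℕ))))⟩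
end

section
/- Let p be a prime, e ≥ 1 and n ≥ 1 integers, and let C be a ℤ_{p^e}-submodule of (ℤ_{p^e})^n whose subtype is (k_0, k_1, ..., k_{e−1}), i.e., C is isomorphic as an additive group to ⊕_{i=0}^{e−1} (ℤ_{p^{e−i}})^{k_i}. Then the rank of the dual code C^⊥ = {x ∈ (ℤ_{p^e})^n : Σ_i x_i·c_i = 0 for all c ∈ C}, defined as the minimal cardinality of a generating set of C^⊥ as a ℤ_{p^e}-module, equals n − k_0. -/
/-- Two surjections with the same fibres have equipotent codomains. -/
theorem Nat.card_eq_of_surjective_of_fibres {α β γ : Type*} (f : α → β) (g : α → γ)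
    (hf : Function.Surjective f) (hg : Function.Surjective g)
    (h : ∀ a b, f a = f b ↔ g a = g b) : Nat.card β = Nat.card γ := by
  have hker : Setoid.ker f = Setoid.ker g := Setoid.ext h
  rw [← Nat.card_congr (Setoid.quotientKerEquivOfSurjective f hf),
    ← Nat.card_congr (Setoid.quotientKerEquivOfSurjective g hg), hker]

/-- An endomorphism of a finite module has cokernel and kernel of the same cardinality. -/
theorem LinearMap.card_quotient_range_eq_card_ker {R M : Type*} [Ring R] [AddCommGroup M]
    [Module R M] [Finite M] (φ : M →ₗ[R] M) :
    Nat.card (M ⧸ LinearMap.range φ) = Nat.card (LinearMap.ker φ) := by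
  refine Nat.eq_of_mul_eq_mul_left (Nat.card_pos (α := LinearMap.range φ)) ?_
  rw [← Submodule.card_eq_card_quotient_mul_card,
    Submodule.card_eq_card_quotient_mul_card (LinearMap.ker φ),
    Nat.card_congr φ.quotKerEquivRange.toEquiv, mul_comm]

theorem finrank_dualCode {K : Type*} [Field K] {n : ℕ} (W : Submodule K (Fin n → K)) :
    Module.finrank K (dualCode W) = n - Module.finrank K W := by
  have h : dualCode W = W.dualAnnihilator.comap (dotProductEquiv K (Fin n)).toLinearMap := by
    ext x
    simp [dualCode, Submodule.mem_dualAnnihilator, dotProduct]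
  have h₁ := Subspace.finrank_add_finrank_dualAnnihilator_eq W
  rw [Module.finrank_fin_fun] at h₁
  have h₂ := (dotProductEquiv K (Fin n)).symm.finrank_map_eq W.dualAnnihilator
  rw [Submodule.map_equiv_eq_comap_symm, LinearEquiv.symm_symm, ← h] at h₂
  omega

theorem Submodule.sInf_card_span_eq_spanFinrank {R M : Type*} [Ring R] [AddCommGroup M]
    [Module R M] (N : Submodule R M) :
    sInf {c : ℕ | ∃ S : Finset M, S.card = c ∧ Submodule.span R (S : Set M) = N}
      = N.spanFinrank := by
  rw [Submodule.spanFinrank_eq_iInf, iInf]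
  congr 1
  ext c
  simp [and_comm]

section ZModPrimePow

variable {p : ℕ}

theorem ZMod.natCast_surjective_of_pow {e : ℕ} (hp : 0 < p) :
    Function.Surjective (Nat.cast : ℕ → ZMod (p ^ e)) :=
  have : NeZero (p ^ e) := ⟨(pow_pos hp e).ne'⟩
  ZMod.natCast_zmod_surjective

theorem ZMod.pow_pred_mul_eq_zero_iff {e : ℕ} (hp : 0 < p) (he : 0 < e) (x : ZMod (p ^ e)) :
    (p : ZMod (p ^ e)) ^ (e - 1) * x = 0 ↔
      ZMod.castHom (dvd_pow_self p he.ne') (ZMod p) x = 0 := by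
  obtain ⟨k, rfl⟩ := ZMod.natCast_surjective_of_pow hp x
  obtain ⟨e, rfl⟩ := Nat.exists_eq_add_of_lt he
  have : 0 < p ^ e := pow_pos hp e
  rw [map_natCast, ZMod.natCast_eq_zero_iff, ← Nat.cast_pow, ← Nat.cast_mul,
    ZMod.natCast_eq_zero_iff]
  simp only [zero_add, Nat.add_sub_cancel, pow_succ]
  exact Nat.mul_dvd_mul_iff_left this

theorem ZMod.exists_eq_pow_pred_mul {e : ℕ} (hp : 0 < p) (he : 0 < e) {x : ZMod (p ^ e)}
    (hx : (p : ZMod (p ^ e)) * x = 0) : ∃ y, x = (p : ZMod (p ^ e)) ^ (e - 1) * y := by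
  obtain ⟨k, rfl⟩ := ZMod.natCast_surjective_of_pow hp x
  obtain ⟨e, rfl⟩ := Nat.exists_eq_add_of_lt he
  rw [← Nat.cast_mul, ZMod.natCast_eq_zero_iff, zero_add, pow_succ',
    Nat.mul_dvd_mul_iff_left hp] at hx
  obtain ⟨m, rfl⟩ := hx
  exact ⟨m, by simp⟩

theorem ZMod.ker_castHom_prime_pow {e : ℕ} (hp : 0 < p) (he : 0 < e) :
    RingHom.ker (ZMod.castHom (dvd_pow_self p he.ne') (ZMod p)) =
      Ideal.span {(p : ZMod (p ^ e))} := by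
  ext x
  rw [RingHom.mem_ker, Ideal.mem_span_singleton]
  constructor
  · obtain ⟨k, rfl⟩ := ZMod.natCast_surjective_of_pow hp x
    rw [map_natCast, ZMod.natCast_eq_zero_iff]
    exact fun h ↦ Nat.cast_dvd_cast h
  · rintro ⟨y, rfl⟩
    rw [map_mul, map_natCast, ZMod.natCast_self, zero_mul]

theorem ZMod.isLocalRing_prime_pow [Fact p.Prime] {e : ℕ} (he : 0 < e) :
    IsLocalRing (ZMod (p ^ e)) :=
  have : Fact (1 < p ^ e) := ⟨Nat.one_lt_pow he.ne' (Fact.out : p.Prime).one_lt⟩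
  IsLocalRing.of_surjective' (PadicInt.toZModPow e) (ZMod.ringHom_surjective _)

/-- The minimal number of generators of a module over `ℤ/pᵉ` is determined by the cardinality of
its `p`-torsion. -/
theorem ZMod.pow_spanFinrank_eq_card_torsion [Fact p.Prime] {e : ℕ} (he : 0 < e) {M : Type*}
    [AddCommGroup M] [Module (ZMod (p ^ e)) M] [Finite M] (N : Submodule (ZMod (p ^ e)) M) :
    p ^ N.spanFinrank = Nat.card {x : N // (p : ZMod (p ^ e)) • x = 0} := by
  have hp : 0 < p := (Fact.out : p.Prime).pos
  have := ZMod.isLocalRing_prime_pow (p := p) he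
  set f := ZMod.castHom (dvd_pow_self p he.ne') (ZMod p) with hf
  have hfs : Function.Surjective f := ZMod.ringHom_surjective f
  have hmax : IsLocalRing.maximalIdeal (ZMod (p ^ e)) = RingHom.ker f :=
    (IsLocalRing.eq_maximalIdeal (RingHom.ker_isMaximal_of_surjective f hfs)).symm
  have hcard : Nat.card (ZMod (p ^ e) ⧸ IsLocalRing.maximalIdeal (ZMod (p ^ e))) = p := by
    rw [hmax, Nat.card_congr (RingHom.quotientKerEquivOfSurjective hfs).toEquiv, Nat.card_zmod]
  let φ : N →ₗ[ZMod (p ^ e)] N := LinearMap.lsmul (ZMod (p ^ e)) N (p : ZMod (p ^ e))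
  have hrange : IsLocalRing.maximalIdeal (ZMod (p ^ e)) • (⊤ : Submodule (ZMod (p ^ e)) N) =
      LinearMap.range φ := by
    rw [hmax, hf, ZMod.ker_castHom_prime_pow hp he, Submodule.ideal_span_singleton_smul]
    ext x
    simp [φ, Submodule.mem_smul_pointwise_iff_exists]
  let : Field (ZMod (p ^ e) ⧸ IsLocalRing.maximalIdeal (ZMod (p ^ e))) :=
    Ideal.Quotient.field _
  have hfin : Finite (ZMod (p ^ e) ⧸ IsLocalRing.maximalIdeal (ZMod (p ^ e))) :=
    Nat.finite_of_card_ne_zero (by rw [hcard]; exact hp.ne')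
  have hq := Module.natCard_eq_pow_finrank
    (K := ZMod (p ^ e) ⧸ IsLocalRing.maximalIdeal (ZMod (p ^ e)))
    (V := N ⧸ IsLocalRing.maximalIdeal (ZMod (p ^ e)) • (⊤ : Submodule (ZMod (p ^ e)) N))
  rw [hcard] at hq
  rw [IsLocalRing.spanFinrank_eq_finrank_quotient N
    (Module.Finite.iff_fg.1 inferInstance), ← hq, hrange,
    LinearMap.card_quotient_range_eq_card_ker]
  rfl

variable {e n : ℕ}

instance ZMod.ringHomSurjective_castHom {m n : ℕ} (h : m ∣ n) :
    RingHomSurjective (ZMod.castHom h (ZMod m)) :=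
  ⟨ZMod.castHom_surjective h⟩

/-- Coordinatewise reduction `(ℤ/pᵉ)ⁿ → (ℤ/p)ⁿ`. -/
def ZMod.reduction (p : ℕ) {e : ℕ} (he : 0 < e) (n : ℕ) :
    (Fin n → ZMod (p ^ e)) →ₛₗ[ZMod.castHom (dvd_pow_self p he.ne') (ZMod p)]
      (Fin n → ZMod p) where
  toFun x i := ZMod.castHom (dvd_pow_self p he.ne') (ZMod p) (x i)
  map_add' x y := funext fun i ↦ map_add _ (x i) (y i)
  map_smul' r x := funext fun i ↦ map_mul _ r (x i)

theorem ZMod.reduction_surjective (he : 0 < e) :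
    Function.Surjective (ZMod.reduction p he n) := fun y ↦ by
  choose x hx using fun i ↦ ZMod.castHom_surjective (dvd_pow_self p he.ne') (y i)
  exact ⟨x, funext hx⟩

variable [Fact p.Prime]

theorem ZMod.pow_pred_smul_eq_zero_iff (he : 0 < e) (x : Fin n → ZMod (p ^ e)) :
    (p : ZMod (p ^ e)) ^ (e - 1) • x = 0 ↔ ZMod.reduction p he n x = 0 := by
  simp only [funext_iff, Pi.smul_apply, smul_eq_mul, Pi.zero_apply,
    ZMod.pow_pred_mul_eq_zero_iff (Fact.out : p.Prime).pos he]
  rfl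

theorem ZMod.pow_pred_smul_mem_dualCode_iff (he : 0 < e)
    (C : Submodule (ZMod (p ^ e)) (Fin n → ZMod (p ^ e))) (x : Fin n → ZMod (p ^ e)) :
    (p : ZMod (p ^ e)) ^ (e - 1) • x ∈ dualCode C ↔
      ZMod.reduction p he n x ∈ dualCode (C.map (ZMod.reduction p he n)) := by
  change (∀ c ∈ C, ∑ i, ((p : ZMod (p ^ e)) ^ (e - 1) * x i) * c i = 0) ↔
    ∀ d ∈ C.map (ZMod.reduction p he n), ∑ i, ZMod.reduction p he n x i * d i = 0
  simp only [Submodule.mem_map, forall_exists_index, and_imp, forall_apply_eq_imp_iff₂, mul_assoc,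
    ← Finset.mul_sum, ZMod.pow_pred_mul_eq_zero_iff (Fact.out : p.Prime).pos he, map_sum, map_mul]
  rfl

/-- The `p`-torsion of the dual code is in bijection with the dual of the reduction mod `p`. -/
theorem ZMod.card_torsion_dualCode (he : 0 < e)
    (C : Submodule (ZMod (p ^ e)) (Fin n → ZMod (p ^ e))) :
    Nat.card {x : dualCode C // (p : ZMod (p ^ e)) • x = 0} =
      Nat.card (dualCode (C.map (ZMod.reduction p he n))) := by
  have hp : 0 < p := (Fact.out : p.Prime).pos
  have hpe : (p : ZMod (p ^ e)) * (p : ZMod (p ^ e)) ^ (e - 1) = 0 := by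
    rw [← pow_succ', Nat.sub_add_cancel he, ← Nat.cast_pow, ZMod.natCast_self]
  let A := {x : Fin n → ZMod (p ^ e) // (p : ZMod (p ^ e)) ^ (e - 1) • x ∈ dualCode C}
  refine Nat.card_eq_of_surjective_of_fibres
    (fun x : A ↦ ⟨⟨(p : ZMod (p ^ e)) ^ (e - 1) • x.1, x.2⟩, ?_⟩)
    (fun x : A ↦ ⟨ZMod.reduction p he n x.1, (ZMod.pow_pred_smul_mem_dualCode_iff he C _).1 x.2⟩)
    ?_ ?_ ?_
  · ext1
    simp [smul_smul, hpe]
  · rintro ⟨⟨y, hy⟩, hpy⟩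
    have hpy' : ∀ i, (p : ZMod (p ^ e)) * y i = 0 := congrFun (congrArg Subtype.val hpy)
    choose x hx using fun i ↦ ZMod.exists_eq_pow_pred_mul hp he (hpy' i)
    obtain rfl : y = (p : ZMod (p ^ e)) ^ (e - 1) • x := funext hx
    exact ⟨⟨x, hy⟩, rfl⟩
  · rintro ⟨y, hy⟩
    obtain ⟨x, rfl⟩ := ZMod.reduction_surjective he y
    exact ⟨⟨x, (ZMod.pow_pred_smul_mem_dualCode_iff he C x).2 hy⟩, rfl⟩
  · rintro ⟨a, ha⟩ ⟨b, hb⟩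
    simp only [Subtype.mk.injEq]
    rw [← sub_eq_zero, ← smul_sub, ZMod.pow_pred_smul_eq_zero_iff he, map_sub, sub_eq_zero]

theorem ZMod.card_map_reduction (he : 0 < e)
    (C : Submodule (ZMod (p ^ e)) (Fin n → ZMod (p ^ e))) (k : ℕ → ℕ)
    (ψ : C ≃+ ((i : Fin e) → Fin (k i) → ZMod (p ^ (e - (i : ℕ))))) :
    Nat.card (C.map (ZMod.reduction p he n)) = p ^ k 0 := by
  have hp : 0 < p := (Fact.out : p.Prime).pos
  let i₀ : Fin e := ⟨0, he⟩
  let g : C → Fin (k 0) → ZMod p := fun c ↦ ZMod.reduction p he (k 0) (ψ c i₀)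
  have hg : Function.Surjective g := fun y ↦ by
    obtain ⟨x, rfl⟩ := ZMod.reduction_surjective he y
    exact ⟨ψ.symm (Pi.single i₀ x), by simp [g, i₀]⟩
  have hker (c : C) : g c = 0 ↔ ZMod.reduction p he n c.1 = 0 := by
    rw [← ZMod.pow_pred_smul_eq_zero_iff he, ← ZMod.pow_pred_smul_eq_zero_iff he]
    have h₁ : (p : ZMod (p ^ e)) ^ (e - 1) • c.1 = 0 ↔ p ^ (e - 1) • c = 0 := by
      rw [← Nat.cast_pow, Nat.cast_smul_eq_nsmul, ← Submodule.coe_smul_of_tower, Submodule.coe_eq_zero]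
    rw [h₁, ← map_eq_zero_iff ψ ψ.injective, map_nsmul, ← Nat.cast_pow, Nat.cast_smul_eq_nsmul]
    refine ⟨fun h ↦ funext fun i ↦ ?_, fun h ↦ congrFun h i₀⟩
    by_cases hi : (i : ℕ) = 0
    · obtain rfl : i = i₀ := Fin.ext hi
      exact h
    · ext j
      have hz : ((p ^ (e - 1) : ℕ) : ZMod (p ^ (e - (i : ℕ)))) = 0 :=
        (ZMod.natCast_eq_zero_iff _ _).2 (pow_dvd_pow p (by omega))
      simp only [Pi.smul_apply, nsmul_eq_mul, hz, zero_mul, Pi.zero_apply]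
  have hsub (a b : C) : g a - g b = g (a - b) := by
    simp only [g, map_sub]
    rw [← map_sub]; rfl
  have h := Nat.card_eq_of_surjective_of_fibres g
    (fun c ↦ (⟨ZMod.reduction p he n c.1, Submodule.mem_map_of_mem c.2⟩ :
      C.map (ZMod.reduction p he n))) hg ?_ ?_
  · rw [← h]
    simp
  · rintro ⟨_, x, hx, rfl⟩
    exact ⟨⟨x, hx⟩, rfl⟩
  · intro a b
    rw [← sub_eq_zero, hsub, hker, Subtype.mk.injEq, Submodule.coe_sub, map_sub, sub_eq_zero]

end ZModPrimePow

/-- If `C` has subtype `(k₀, ..., k_{e-1})`, then the rank of the dual code, i.e.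
the minimal cardinality of a generating set of `C^⊥` as a `ℤ/pᵉ`-module,
equals `n - k₀`. -/
theorem stmt_8 (p e n : ℕ) (hp : p.Prime) (he : 0 < e) (hn : 0 < n)
    (C : Submodule (ZMod (p ^ e)) (Fin n → ZMod (p ^ e)))
    (k : ℕ → ℕ)
    (hsub : Nonempty (C ≃+ ((i : Fin e) → Fin (k i) → ZMod (p ^ (e - (i : ℕ)))))) :
    sInf {c : ℕ | ∃ S : Finset (Fin n → ZMod (p ^ e)), S.card = c ∧
        Submodule.span (ZMod (p ^ e)) (S : Set (Fin n → ZMod (p ^ e))) = dualCode C}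
      = n - k 0 := by
  have : Fact p.Prime := ⟨hp⟩
  have : NeZero (p ^ e) := ⟨(pow_pos hp.pos e).ne'⟩
  obtain ⟨ψ⟩ := hsub
  let W := C.map (ZMod.reduction p he n)
  have hW : Module.finrank (ZMod p) W = k 0 := by
    have h := Module.natCard_eq_pow_finrank (K := ZMod p) (V := W)
    rw [ZMod.card_map_reduction he C k ψ, Nat.card_zmod] at h
    exact (Nat.pow_right_injective hp.two_le h).symm
  have hrank := ZMod.pow_spanFinrank_eq_card_torsion he (dualCode C)
  rw [ZMod.card_torsion_dualCode he, Module.natCard_eq_pow_finrank (K := ZMod p), Nat.card_zmod,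
    finrank_dualCode, hW] at hrank
  rw [Submodule.sInf_card_span_eq_spanFinrank]
  exact Nat.pow_right_injective hp.two_le hrank
end

section
/- Let p be a prime, e ≥ 1 an integer, and n ≥ 1 an integer with p not dividing n, and let R = (ℤ_{p^e})[x] / ⟨x^n − 1⟩. Let s be an integer with 0 ≤ s < e, let 0 ≤ a_0 < a_1 < ... < a_s < e be integers, and let g_{a_0}, g_{a_1}, ..., g_{a_s} be monic polynomials over ℤ_{p^e} with deg(g_{a_j}) > deg(g_{a_{j+1}}) for all 0 ≤ j < s and with the divisibility chain g_{a_s} | g_{a_{s−1}} | ... | g_{a_0} | (x^n − 1) in (ℤ_{p^e})[x]. Then the ideal of R generated by the images of the s+1 elements p^{a_0}·g_{a_0}(x), p^{a_1}·g_{a_1}(x), ..., p^{a_s}·g_{a_s}(x) is equal to the ideal of R generated by the image of the single element Σ_{j=0}^{s} p^{a_j}·g_{a_j}(x). -/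
/-- Perturbing by a nilpotent multiple preserves coprimality. -/
theorem IsCoprime.add_nilpotent_mul {A : Type*} [CommRing A] {g h π : A}
    (hgh : IsCoprime g h) (hπ : IsNilpotent π) (t : A) : IsCoprime (g + π * t) h := by
  obtain ⟨u, v, huv⟩ := hgh
  have hnil : IsNilpotent (π * (u * t)) := (Commute.all π (u * t)).isNilpotent_mul_right hπ
  obtain ⟨w, hw⟩ := hnil.isUnit_one_add.exists_left_inv
  exact ⟨w * u, w * v, by linear_combination hw + w * huv⟩

/-- If each `g j` is a factor of `f` coprime to its cofactor, then an ideal containing `f` and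
the sum of the `π ^ a j * g j`, with `π` nilpotent and `a` strictly increasing, contains
each summand. -/
theorem Ideal.pow_mul_mem_of_sum_mem {A : Type*} [CommRing A] {π f : A} (hπ : IsNilpotent π)
    {J : Ideal A} (hf : f ∈ J) {m : ℕ} {a : Fin m → ℕ} (ha : StrictMono a) {g : Fin m → A}
    (hg : ∀ j, ∃ h, f = g j * h ∧ IsCoprime (g j) h)
    (hsum : ∑ j, π ^ a j * g j ∈ J) (j : Fin m) : π ^ a j * g j ∈ J := by
  induction m with
  | zero => exact j.elim0
  | succ m ih =>
    have hdvd : π ^ (a 0 + 1) ∣ ∑ i : Fin m, π ^ a i.succ * g i.succ :=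
      Finset.dvd_sum fun i _ =>
        Dvd.dvd.mul_right (pow_dvd_pow π (ha (Fin.succ_pos i))) _
    obtain ⟨t, ht⟩ := hdvd
    obtain ⟨h, hfh, hco⟩ := hg 0
    obtain ⟨u, v, huv⟩ := hco.add_nilpotent_mul hπ t
    rw [Fin.sum_univ_succ] at hsum
    have h0 : π ^ a 0 * g 0 ∈ J := by
      have key : π ^ a 0 * g 0 = g 0 * u * (π ^ a 0 * g 0 +
          ∑ i : Fin m, π ^ a i.succ * g i.succ) + π ^ a 0 * v * f := by
        rw [ht, hfh]
        linear_combination (-(π ^ a 0 * g 0)) * huv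
      rw [key]
      exact J.add_mem (J.mul_mem_left _ hsum) (J.mul_mem_left _ hf)
    have htail := (J.add_mem_iff_right h0).1 hsum
    refine Fin.cases h0 (fun i => ?_) j
    exact ih (a := fun i => a i.succ) (g := fun i => g i.succ)
      (fun _ _ hij => ha (Fin.succ_lt_succ_iff.2 hij)) (fun i => hg i.succ) htail i


/-- A generating set in standard form `{p^{a₀} g_{a₀}(x), ..., p^{a_s} g_{a_s}(x)}`
of a cyclic code over `ℤ/pᵉ` (strictly increasing exponents `aⱼ < e`, monic `g_{aⱼ}`
of strictly decreasing degrees, divisibility chain ending at `xⁿ - 1`) generates the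
same ideal of `(ℤ/pᵉ)[x]/⟨xⁿ - 1⟩` as the single generator `Σⱼ p^{aⱼ} g_{aⱼ}(x)`. -/
theorem stmt_11 (p e n s : ℕ) (hp : p.Prime) (he : 0 < e) (hn : 0 < n)
    (hpn : ¬ p ∣ n) (hs : s < e)
    (a : Fin (s + 1) → ℕ) (ha_mono : StrictMono a) (ha_lt : ∀ j, a j < e)
    (g : Fin (s + 1) → Polynomial (ZMod (p ^ e)))
    (hg_monic : ∀ j, (g j).Monic)
    (hg_deg : ∀ (j : ℕ) (h : j + 1 < s + 1),
      (g ⟨j + 1, h⟩).degree < (g ⟨j, Nat.lt_of_succ_lt h⟩).degree)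
    (hg_dvd : ∀ (j : ℕ) (h : j + 1 < s + 1),
      g ⟨j + 1, h⟩ ∣ g ⟨j, Nat.lt_of_succ_lt h⟩)
    (hg0 : g 0 ∣ (Polynomial.X : Polynomial (ZMod (p ^ e))) ^ n - 1) :
    Ideal.span (Set.range fun j : Fin (s + 1) =>
        Ideal.Quotient.mk
          (Ideal.span {(Polynomial.X : Polynomial (ZMod (p ^ e))) ^ n - 1})
          ((p : Polynomial (ZMod (p ^ e))) ^ (a j) * g j))
      = Ideal.span
          {Ideal.Quotient.mk
            (Ideal.span {(Polynomial.X : Polynomial (ZMod (p ^ e))) ^ n - 1})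
            (∑ j : Fin (s + 1), (p : Polynomial (ZMod (p ^ e))) ^ (a j) * g j)} := by
  have hdvd : ∀ j, g j ∣ (Polynomial.X : Polynomial (ZMod (p ^ e))) ^ n - 1 := by
    rintro ⟨j, hj⟩
    induction j with
    | zero => exact hg0
    | succ j ih => exact (hg_dvd j hj).trans (ih _)
  have hunit : IsUnit (n : ZMod (p ^ e)) :=
    (ZMod.isUnit_iff_coprime n (p ^ e)).2
      (((Nat.Prime.coprime_iff_not_dvd hp).2 hpn).symm.pow_right e)
  have hsep : ((Polynomial.X : Polynomial (ZMod (p ^ e))) ^ n - 1).Separable := by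
    simpa using Polynomial.separable_X_pow_sub_C_unit (1 : (ZMod (p ^ e))ˣ) hunit
  have hnil : IsNilpotent (p : Polynomial (ZMod (p ^ e))) :=
    ⟨e, by exact_mod_cast CharP.cast_eq_zero (Polynomial (ZMod (p ^ e))) (p ^ e)⟩
  apply le_antisymm
  · rw [Ideal.span_le]
    rintro _ ⟨j, rfl⟩
    refine Ideal.pow_mul_mem_of_sum_mem hnil
      (f := Polynomial.X ^ n - 1)
      (J := (Ideal.span _).comap (Ideal.Quotient.mk _)) ?_ ha_mono (fun j => ?_)
      (Ideal.mem_span_singleton_self _) j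
    · rw [Ideal.mem_comap, Ideal.Quotient.eq_zero_iff_mem.2 (Ideal.mem_span_singleton_self _)]
      exact Ideal.zero_mem _
    · obtain ⟨h, hh⟩ := hdvd j
      exact ⟨h, hh, Polynomial.Separable.isCoprime (hh ▸ hsep)⟩
  · rw [Ideal.span_singleton_le_iff_mem, map_sum]
    exact Ideal.sum_mem _ fun j _ => Ideal.subset_span ⟨j, rfl⟩
end

section
/- Let p ≥ 2 be an integer and let R' be a real number with 0 < R' < 1/2. Then the products ∏_{i=0}^{⌊R'·n⌋−1} (1 − p^{i−n}) converge to 1 as n → ∞. -/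
/-- Partial products of `1 - p ^ (i - n)` over `i < k ≤ n` lie between `1 - p ^ (k - n)` and `1`. -/
lemma prod_one_sub_zpow_mem_Icc {p : ℝ} (hp : 2 ≤ p) (n : ℕ) {k : ℕ} (hk : k ≤ n) :
    ∏ i ∈ Finset.range k, (1 - p ^ ((i : ℤ) - (n : ℤ))) ∈
      Set.Icc (1 - p ^ ((k : ℤ) - (n : ℤ))) 1 := by
  have hp0 : 0 < p := by linarith
  induction k with
  | zero => simpa using (pow_pos hp0 n).le
  | succ k ih =>
    obtain ⟨hl, hu⟩ := ih (by omega)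
    have hx0 : 0 < p ^ ((k : ℤ) - (n : ℤ)) := zpow_pos hp0 _
    have hx1 : p ^ ((k : ℤ) - (n : ℤ)) ≤ 1 :=
      zpow_le_one_of_nonpos₀ (by linarith) (by omega)
    have hs : p ^ (((k + 1 : ℕ) : ℤ) - (n : ℤ)) = p ^ ((k : ℤ) - (n : ℤ)) * p := by
      rw [← zpow_add_one₀ hp0.ne']
      congr 1
      push_cast
      ring
    rw [Finset.prod_range_succ, hs]
    constructor <;> nlinarith

/-- For `p ≥ 2` and a rate `0 < R' < 1/2`, the products
`∏_{i < ⌊R'·n⌋} (1 - p^{i-n})` tend to `1` as `n → ∞`: random codes of rate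
below `1/2` over a finite chain ring are free with high probability. -/
theorem stmt_13 (p : ℕ) (hp : 2 ≤ p) (R' : ℝ) (h0 : 0 < R') (h2 : R' < 1 / 2) :
    Filter.Tendsto
      (fun n : ℕ => ∏ i ∈ Finset.range ⌊R' * n⌋₊, (1 - (p : ℝ) ^ ((i : ℤ) - (n : ℤ))))
      Filter.atTop (nhds 1) := by
  have hp' : (2 : ℝ) ≤ p := by exact_mod_cast hp
  have hk (n : ℕ) : ⌊R' * n⌋₊ ≤ n / 2 := by
    have hle : R' * n ≤ (n : ℝ) / (2 : ℕ) := by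
      push_cast
      nlinarith [(Nat.cast_nonneg n : (0 : ℝ) ≤ n)]
    exact (Nat.floor_mono hle).trans_eq (Nat.floor_div_eq_div n 2)
  have hlim : Filter.Tendsto (fun n : ℕ => 1 - ((p : ℝ)⁻¹) ^ (n / 2)) Filter.atTop (nhds 1) := by
    have hpow : Filter.Tendsto (fun m : ℕ => ((p : ℝ)⁻¹) ^ m) Filter.atTop (nhds 0) :=
      tendsto_pow_atTop_nhds_zero_of_lt_one (by positivity) (inv_lt_one_of_one_lt₀ (by linarith))
    simpa using (hpow.comp (Nat.tendsto_div_const_atTop two_ne_zero)).const_sub 1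
  refine tendsto_of_tendsto_of_tendsto_of_le_of_le hlim tendsto_const_nhds (fun n => ?_)
    fun n => (prod_one_sub_zpow_mem_Icc hp' n ((hk n).trans (Nat.div_le_self n 2))).2
  refine le_trans ?_ (prod_one_sub_zpow_mem_Icc hp' n ((hk n).trans (Nat.div_le_self n 2))).1
  have hle : (p : ℝ) ^ ((⌊R' * n⌋₊ : ℤ) - (n : ℤ)) ≤ (p : ℝ) ^ (-((n / 2 : ℕ) : ℤ)) :=
    zpow_le_zpow_right₀ (by linarith) (by have := hk n; omega)
  rw [zpow_neg, zpow_natCast, ← inv_pow] at hle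
  linarith
end
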